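/- arXiv:1910.12502 — 8 statements merged into one kernel-verified Lean document; each statement's English description precedes it below -/
import Mathlib

section
/- Let M be an n×n symmetric integer matrix, let 1 ≤ k ≤ n, and let λ ∈ ℂ be a common root of all polynomials in the k-th determinantal ideal I_k^ℤ(xI_n − M) ⊆ ℤ[x], i.e. p(λ) = 0 for every p in this ideal (with integer coefficients viewed in ℂ). Then: (1) λ is an eigenvalue of M, i.e. a root of the characteristic polynomial of M; (2) λ is a real number; and (3) λ divides Δ_k(M) in the ring of algebraic integers, i.e. there exists μ ∈ ℂ integral over ℤ with λ·μ = Δ_k(M). -/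
/-- The `k`-th determinantal ideal of a matrix `M`: the ideal generated by all
`k`-minors of `M`. -/
def detIdeal {R : Type*} [CommRing R] {n m : ℕ} (M : Matrix (Fin n) (Fin m) R)
    (k : ℕ) : Ideal R :=
  Ideal.span { d : R | ∃ (r : Fin k → Fin n) (c : Fin k → Fin m),
    Function.Injective r ∧ Function.Injective c ∧ d = (M.submatrix r c).det }

/-- `Δ_k(M)`: the nonnegative gcd of all `k`-minors of the integer matrix `M`. -/
def Delta {n : ℕ} (M : Matrix (Fin n) (Fin n) ℤ) (k : ℕ) : ℤ :=
  Finset.gcd Finset.univ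
    (fun p : (Fin k → Fin n) × (Fin k → Fin n) =>
      if Function.Injective p.1 ∧ Function.Injective p.2 then
        (M.submatrix p.1 p.2).det else 0)

/-- If all `k`-minors of `M` vanish, so do all larger minors. -/
theorem Matrix.det_submatrix_eq_zero_of_minors_eq_zero {R : Type*} [CommRing R] {n m k l : ℕ}
    (M : Matrix (Fin n) (Fin m) R) (hkl : k ≤ l)
    (h : ∀ (r : Fin k → Fin n) (c : Fin k → Fin m), Function.Injective r → Function.Injective c →
      (M.submatrix r c).det = 0)
    (r : Fin l → Fin n) (c : Fin l → Fin m) (hr : Function.Injective r)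
    (hc : Function.Injective c) : (M.submatrix r c).det = 0 := by
  induction l, hkl using Nat.le_induction with
  | base => exact h r c hr hc
  | succ l _ ih =>
    rw [Matrix.det_succ_row_zero]
    refine Finset.sum_eq_zero fun j _ => ?_
    rw [Matrix.submatrix_submatrix, ih _ _ (hr.comp (Fin.succ_injective l))
      (hc.comp Fin.succAbove_right_injective), mul_zero]

/-- The complex roots of the characteristic polynomial of a symmetric integer matrix are real. -/
theorem Matrix.IsSymm.im_eq_zero_of_aeval_charpoly_eq_zero {ι : Type*} [Fintype ι] [DecidableEq ι]
    {M : Matrix ι ι ℤ} (hM : M.IsSymm) {z : ℂ} (hz : Polynomial.aeval z M.charpoly = 0) :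
    z.im = 0 := by
  have hA : (M.map (Int.castRingHom ℂ)).IsHermitian := by
    ext i j
    simp [hM.apply i j]
  rw [Polynomial.aeval_def, ← Polynomial.eval_map, algebraMap_int_eq, ← Matrix.charpoly_map,
    hA.charpoly_eq, Polynomial.eval_prod, Finset.prod_eq_zero_iff] at hz
  obtain ⟨i, -, hi⟩ := hz
  rw [Polynomial.eval_sub, Polynomial.eval_X, Polynomial.eval_C, sub_eq_zero] at hi
  rw [hi]
  exact Complex.ofReal_im _

/-- The constant coefficient of a minor of `xI - M` is, up to sign, the minor of `M`. -/
theorem Matrix.eval_zero_det_charmatrix_submatrix {R ι κ : Type*} [CommRing R] [DecidableEq ι]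
    [Fintype ι] [DecidableEq κ] [Fintype κ] (M : Matrix ι ι R) (r c : κ → ι) :
    (M.charmatrix.submatrix r c).det.eval 0 =
      (-1) ^ Fintype.card κ * (M.submatrix r c).det := by
  rw [← Matrix.det_neg, ← Polynomial.coe_evalRingHom, RingHom.map_det]
  congr 1
  ext i j
  by_cases hij : r i = c j <;> simp [hij]

/-- `Δ_k(M)` lies in every ideal of `ℤ` containing all `k`-minors of `M`. -/
theorem Delta_mem {n : ℕ} (M : Matrix (Fin n) (Fin n) ℤ) (k : ℕ) (J : Ideal ℤ)
    (hJ : ∀ r c : Fin k → Fin n, Function.Injective r → Function.Injective c →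
      (M.submatrix r c).det ∈ J) : Delta M k ∈ J := by
  rw [← J.span_singleton_generator, Ideal.mem_span_singleton]
  refine Finset.dvd_gcd fun p _ => ?_
  split_ifs with hp
  · exact (Submodule.IsPrincipal.mem_iff_generator_dvd J).1 (hJ _ _ hp.1 hp.2)
  · exact dvd_zero _

/-- Let `M` be a symmetric integer matrix, `1 ≤ k ≤ n`, and `λ ∈ ℂ` a common root of all
polynomials in the `k`-th determinantal ideal of `xI − M` over `ℤ[x]`. Then `λ` is an
eigenvalue of `M` (a root of its characteristic polynomial), `λ` is real, and `λ`
divides `Δ_k(M)` in the ring of algebraic integers. -/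
theorem root_of_detIdeal_charmatrix {n : ℕ} (M : Matrix (Fin n) (Fin n) ℤ)
    (hM : M.IsSymm) (k : ℕ) (hk1 : 1 ≤ k) (hkn : k ≤ n) (lam : ℂ)
    (hroot : ∀ p ∈ detIdeal M.charmatrix k, Polynomial.aeval lam p = 0) :
    Polynomial.aeval lam M.charpoly = 0 ∧ lam.im = 0 ∧
      ∃ μ : ℂ, IsIntegral ℤ μ ∧ lam * μ = (Delta M k : ℂ) := by
  have hminor (r c : Fin k → Fin n) (hr : Function.Injective r) (hc : Function.Injective c) :
      Polynomial.aeval lam (M.charmatrix.submatrix r c).det = 0 :=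
    hroot _ (Ideal.subset_span ⟨r, c, hr, hc, rfl⟩)
  have hchar : Polynomial.aeval lam M.charpoly = 0 := by
    have h := (M.charmatrix.map (Polynomial.aeval lam)).det_submatrix_eq_zero_of_minors_eq_zero hkn
      (fun r c hr hc => by
        rw [← hminor r c hr hc, AlgHom.map_det]
        rfl) id id Function.injective_id Function.injective_id
    rw [Matrix.charpoly, AlgHom.map_det]
    exact h
  refine ⟨hchar, hM.im_eq_zero_of_aeval_charpoly_eq_zero hchar, ?_⟩
  have hint : IsIntegral ℤ lam := ⟨M.charpoly, M.charpoly_monic, hchar⟩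
  let a : integralClosure ℤ ℂ := ⟨lam, hint⟩
  have hmem : Delta M k ∈ (Ideal.span {a}).comap (algebraMap ℤ (integralClosure ℤ ℂ)) := by
    refine Delta_mem M k _ fun r c hr hc => ?_
    rw [Ideal.mem_comap, Ideal.mem_span_singleton]
    set p := (M.charmatrix.submatrix r c).det with hp
    have ha : Polynomial.aeval a p = 0 := by
      apply Subtype.val_injective
      exact (Polynomial.aeval_algHom_apply (integralClosure ℤ ℂ).val a p).symm.trans
        (hminor r c hr hc)
    have h := Polynomial.sub_dvd_eval_sub a 0 (p.map (algebraMap ℤ (integralClosure ℤ ℂ)))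
    rw [Polynomial.eval_map_algebraMap, ha, Polynomial.eval_zero_map, hp,
      M.eval_zero_det_charmatrix_submatrix r c, sub_zero, zero_sub, dvd_neg, map_mul, map_pow,
      map_neg, map_one] at h
    exact ((isUnit_one.neg.pow _).dvd_mul_left).1 h
  obtain ⟨b, hb⟩ := Ideal.mem_span_singleton.1 (Ideal.mem_comap.1 hmem)
  refine ⟨b, b.2, ?_⟩
  have := congrArg Subtype.val hb
  simpa [a] using this.symm
end

section
/- Let M be an n×n nonsingular (det M ≠ 0) symmetric integer matrix and let λ ∈ ℂ be an eigenvalue of M, i.e. a root of the characteristic polynomial of M. Then λ divides the last invariant factor s_n = Δ_n(M)/Δ_{n−1}(M) of the Smith normal form of M in the ring of algebraic integers; that is, there exists μ ∈ ℂ integral over ℤ such that λ·μ·Δ_{n−1}(M) = Δ_n(M). -/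
open Polynomial in
/-- A complex number is a root of the characteristic polynomial of an integer matrix iff it has
a nonzero eigenvector over `ℂ`. -/
theorem Matrix.aeval_charpoly_eq_zero_iff {ι : Type*} [Fintype ι] [DecidableEq ι]
    (A : Matrix ι ι ℤ) (z : ℂ) :
    aeval z A.charpoly = 0 ↔ ∃ v : ι → ℂ, v ≠ 0 ∧ (A.map (Int.castRingHom ℂ)).mulVec v = z • v := by
  have h : aeval z A.charpoly = (Matrix.scalar ι z - A.map (Int.castRingHom ℂ)).det := by
    rw [← Matrix.eval_charpoly, Matrix.charpoly_map, eval_map, aeval_def]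
    rfl
  rw [h, ← Matrix.exists_mulVec_eq_zero_iff]
  refine exists_congr fun v => and_congr_right fun _ => ?_
  rw [Matrix.sub_mulVec, sub_eq_zero, eq_comm]
  simp [← Matrix.smul_one_eq_diagonal, Matrix.smul_mulVec, Matrix.scalar_apply]

theorem Delta_dvd_adjugate {m : ℕ} (M : Matrix (Fin (m + 1)) (Fin (m + 1)) ℤ)
    (i j : Fin (m + 1)) : Delta M m ∣ M.adjugate i j := by
  rw [Matrix.adjugate_fin_succ_eq_det_submatrix]
  refine Dvd.dvd.mul_left ?_ _
  have h := Finset.gcd_dvd (s := Finset.univ)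
    (f := fun p : (Fin m → Fin (m + 1)) × (Fin m → Fin (m + 1)) =>
      if Function.Injective p.1 ∧ Function.Injective p.2 then (M.submatrix p.1 p.2).det else 0)
    (Finset.mem_univ (j.succAbove, i.succAbove))
  simpa [Delta, Fin.succAbove_right_injective] using h

theorem det_dvd_Delta {n : ℕ} (M : Matrix (Fin n) (Fin n) ℤ) : M.det ∣ Delta M n := by
  refine Finset.dvd_gcd fun p _ => ?_
  split_ifs with hp
  · let e := Equiv.ofBijective p.1 (Finite.injective_iff_bijective.mp hp.1)
    let f := Equiv.ofBijective p.2 (Finite.injective_iff_bijective.mp hp.2)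
    have h : M.submatrix p.1 p.2 = (M.submatrix id f).submatrix e id := rfl
    rw [h, Matrix.det_permute, Matrix.det_permute']
    exact (dvd_mul_left _ _).mul_left _
  · exact dvd_zero _

/-- Rushanan's theorem: if `λ ∈ ℂ` is an eigenvalue of a nonsingular symmetric integer
matrix `M`, then `λ` divides the last invariant factor `s_n = Δ_n(M)/Δ_{n−1}(M)` of the
Smith normal form of `M` in the ring of algebraic integers: there exists an algebraic
integer `μ` with `λ · μ · Δ_{n−1}(M) = Δ_n(M)`. -/
theorem eigenvalue_dvd_last_invariant_factor {n : ℕ} (M : Matrix (Fin n) (Fin n) ℤ)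
    (hM : M.IsSymm) (hdet : M.det ≠ 0) (lam : ℂ)
    (hlam : Polynomial.aeval lam M.charpoly = 0) :
    ∃ μ : ℂ, IsIntegral ℤ μ ∧ lam * μ * (Delta M (n - 1) : ℂ) = (Delta M n : ℂ) := by
  obtain ⟨v, hv, hMv⟩ := (M.aeval_charpoly_eq_zero_iff lam).mp hlam
  obtain _ | m := n
  · exact absurd (Subsingleton.elim v 0) hv
  simp only [Nat.add_sub_cancel]
  choose N hN using Delta_dvd_adjugate M
  obtain ⟨c, hc⟩ := det_dvd_Delta M
  let N' : Matrix (Fin (m + 1)) (Fin (m + 1)) ℤ := Matrix.of N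
  have hadj : Delta M m • N' * M = M.det • (1 : Matrix _ _ ℤ) := by
    rw [← Matrix.adjugate_mul]
    congr 1
    ext i j
    simp [N', hN]
  have hC : ((Delta M m : ℂ) * lam) • (N'.map (Int.castRingHom ℂ)).mulVec v
      = (M.det : ℂ) • v := by
    have h := congrArg (fun A => (A.map (Int.castRingHom ℂ)).mulVec v) hadj
    have h1 : (Delta M m • N').map (Int.castRingHom ℂ)
        = (Delta M m : ℂ) • N'.map (Int.castRingHom ℂ) := by
      ext; simp [-zsmul_eq_mul]
    have h2 : (M.det • (1 : Matrix (Fin (m + 1)) (Fin (m + 1)) ℤ)).map (Int.castRingHom ℂ)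
        = (M.det : ℂ) • (1 : Matrix _ _ ℂ) := by
      ext i j
      by_cases hij : i = j <;> simp [hij, Matrix.smul_apply, -zsmul_eq_mul, -zsmul_one]
    simpa only [Matrix.map_mul, h1, h2, ← Matrix.mulVec_mulVec, hMv, Matrix.smul_mulVec,
      Matrix.mulVec_smul, Matrix.one_mulVec, smul_smul,
      mul_comm (Delta M m : ℂ) lam] using h
  have hdetC : (M.det : ℂ) ≠ 0 := Int.cast_ne_zero.mpr hdet
  have hne : (Delta M m : ℂ) * lam ≠ 0 := by
    intro h
    rw [h, zero_smul] at hC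
    exact smul_ne_zero hdetC hv hC.symm
  have hroot : Polynomial.aeval ((M.det : ℂ) / (Delta M m * lam)) N'.charpoly = 0 := by
    refine (N'.aeval_charpoly_eq_zero_iff _).mpr ⟨v, hv, ?_⟩
    rw [div_eq_inv_mul, ← smul_smul, ← hC, inv_smul_smul₀ hne]
  refine ⟨(M.det : ℂ) / (Delta M m * lam) * c,
    IsIntegral.mul ⟨_, N'.charpoly_monic, hroot⟩ (isIntegral_algebraMap (x := c)), ?_⟩
  rw [hc, Int.cast_mul]
  calc _ = (M.det : ℂ) / (Delta M m * lam) * (Delta M m * lam) * c := by ring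
    _ = _ := by rw [div_mul_cancel₀ _ hne]
end

section
/- Let A and B be n×n symmetric integer matrices. Then the ideals of ℝ[x] generated by the k-minors of xI_n − A and of xI_n − B coincide for every k with 1 ≤ k ≤ n if and only if for every such k the real varieties of the ideals of ℤ[x] generated by the k-minors of xI_n − A and of xI_n − B coincide, i.e. {λ ∈ ℝ : p(λ) = 0 for all p ∈ I_k^ℤ(xI_n − A)} = {λ ∈ ℝ : p(λ) = 0 for all p ∈ I_k^ℤ(xI_n − B)} for all k. -/
/-- The determinantal ideals of the image of a matrix under a ring homomorphism. -/
theorem detIdeal_map {R S : Type*} [CommRing R] [CommRing S] {n m : ℕ} (f : R →+* S)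
    (M : Matrix (Fin n) (Fin m) R) (k : ℕ) :
    detIdeal (M.map f) k = (detIdeal M k).map f := by
  rw [detIdeal, detIdeal, Ideal.map_span]
  congr 1
  ext d
  constructor
  · rintro ⟨r, c, hr, hc, rfl⟩
    exact ⟨_, ⟨r, c, hr, hc, rfl⟩, f.map_det _⟩
  · rintro ⟨_, ⟨r, c, hr, hc, rfl⟩, rfl⟩
    exact ⟨r, c, hr, hc, f.map_det _⟩

theorem detIdeal_transpose {R : Type*} [CommRing R] {n m : ℕ}
    (M : Matrix (Fin n) (Fin m) R) (k : ℕ) : detIdeal M.transpose k = detIdeal M k := by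
  rw [detIdeal, detIdeal]
  congr 1
  ext d
  constructor
  · rintro ⟨r, c, hr, hc, rfl⟩
    exact ⟨c, r, hc, hr, by rw [← Matrix.det_transpose, Matrix.transpose_submatrix,
      Matrix.transpose_transpose]⟩
  · rintro ⟨r, c, hr, hc, rfl⟩
    exact ⟨c, r, hc, hr, by rw [← Matrix.det_transpose, Matrix.transpose_submatrix]⟩

theorem detIdeal_mul_le_right {R : Type*} [CommRing R] {l n m : ℕ}
    (P : Matrix (Fin l) (Fin n) R) (M : Matrix (Fin n) (Fin m) R) (k : ℕ) :
    detIdeal (P * M) k ≤ detIdeal M k := by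
  refine Ideal.span_le.2 ?_
  rintro _ ⟨r, c, -, hc, rfl⟩
  have hexp : ((P * M).submatrix r c).det =
      ∑ s : Fin k → Fin n, (∏ i, P (r i) (s i)) * (M.submatrix s c).det := by
    have hrows : (P * M).submatrix r c =
        fun i => ∑ j, P (r i) j • fun a => M j (c a) := by
      ext i a
      simp [Matrix.mul_apply]
    rw [hrows]
    refine ((Matrix.detRowAlternating (n := Fin k) (R := R)).toMultilinearMap.map_sum
      (fun i j => P (r i) j • fun a => M j (c a))).trans (Finset.sum_congr rfl fun s _ => ?_)
    exact (Matrix.detRowAlternating (n := Fin k) (R := R)).toMultilinearMap.map_smul_univ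
      (fun i => P (r i) (s i)) (fun i a => M (s i) (c a))
  rw [SetLike.mem_coe, hexp]
  refine Ideal.sum_mem _ fun s _ => Ideal.mul_mem_left _ _ ?_
  by_cases hs : Function.Injective s
  · exact Ideal.subset_span ⟨s, c, hs, hc, rfl⟩
  · obtain ⟨i, j, hij, hne⟩ := Function.not_injective_iff.1 hs
    rw [Matrix.det_zero_of_row_eq hne (by ext a; simp [hij])]
    exact zero_mem _

theorem detIdeal_mul_le_left {R : Type*} [CommRing R] {n m l : ℕ}
    (M : Matrix (Fin n) (Fin m) R) (Q : Matrix (Fin m) (Fin l) R) (k : ℕ) :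
    detIdeal (M * Q) k ≤ detIdeal M k := by
  rw [← detIdeal_transpose, Matrix.transpose_mul, ← detIdeal_transpose M]
  exact detIdeal_mul_le_right _ _ k

theorem charmatrix_conj {R : Type*} [CommRing R] {n : ℕ} {P Q : Matrix (Fin n) (Fin n) R}
    (hPQ : P * Q = 1) (M : Matrix (Fin n) (Fin n) R) :
    (P * M * Q).charmatrix =
      P.map Polynomial.C * M.charmatrix * Q.map Polynomial.C := by
  have h : P.map Polynomial.C * Q.map Polynomial.C = (1 : Matrix (Fin n) (Fin n) (Polynomial R)) := by
    rw [← Matrix.map_mul, hPQ]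
    simp
  have hX : P.map Polynomial.C * Matrix.scalar (Fin n) (Polynomial.X : Polynomial R) =
      Matrix.scalar (Fin n) (Polynomial.X : Polynomial R) * P.map Polynomial.C :=
    (Matrix.scalar_commute _ (Commute.all _) _).eq.symm
  simp only [Matrix.charmatrix, RingHom.mapMatrix_apply, Matrix.map_mul, mul_sub, sub_mul]
  rw [hX, mul_assoc (Matrix.scalar (Fin n) _), h, mul_one]

/-- The determinantal ideals of the characteristic matrix are invariant under similarity. -/
theorem detIdeal_charmatrix_conj {R : Type*} [CommRing R] {n : ℕ}
    {P Q : Matrix (Fin n) (Fin n) R} (hPQ : P * Q = 1) (M : Matrix (Fin n) (Fin n) R) (k : ℕ) :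
    detIdeal (P * M * Q).charmatrix k = detIdeal M.charmatrix k := by
  have hle : ∀ {P Q : Matrix (Fin n) (Fin n) R}, P * Q = 1 → ∀ M : Matrix (Fin n) (Fin n) R,
      detIdeal (P * M * Q).charmatrix k ≤ detIdeal M.charmatrix k := fun h M => by
    rw [charmatrix_conj h]
    exact (detIdeal_mul_le_left _ _ k).trans (detIdeal_mul_le_right _ _ k)
  have hQP : Q * P = 1 := mul_eq_one_comm.1 hPQ
  refine le_antisymm (hle hPQ M) ?_
  have h := hle hQP (P * M * Q)
  rwa [show Q * (P * M * Q) * P = (Q * P) * M * (Q * P) by simp only [mul_assoc], hQP, one_mul,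
    mul_one] at h

theorem detIdeal_diagonal_eq_bot_iff {R : Type*} [CommRing R] [IsDomain R] [DecidableEq R] {n : ℕ}
    (v : Fin n → R) (k : ℕ) :
    detIdeal (Matrix.diagonal v) k = ⊥ ↔ (Finset.univ.filter fun i => v i ≠ 0).card < k := by
  rw [detIdeal, Ideal.span_eq_bot]
  constructor
  · intro h
    by_contra! hk
    obtain ⟨t, ht, hcard⟩ := Finset.exists_subset_card_eq hk
    let r : Fin k → Fin n := t.orderEmbOfFin hcard
    have hr : Function.Injective r := (t.orderEmbOfFin hcard).injective
    have h0 := h _ ⟨r, r, hr, hr, rfl⟩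
    rw [Matrix.submatrix_diagonal _ _ hr, Matrix.det_diagonal] at h0
    refine Finset.prod_ne_zero_iff.2 (fun i _ => ?_) h0
    exact (Finset.mem_filter.1 (ht (t.orderEmbOfFin_mem hcard i))).2
  · rintro hk _ ⟨r, c, hr, -, rfl⟩
    by_contra hdet
    have hv : ∀ i, v (r i) ≠ 0 := fun i hi =>
      hdet (Matrix.det_eq_zero_of_row_eq_zero i fun j => by simp [Matrix.diagonal_apply, hi])
    have hcard := Finset.card_le_card_of_injOn (s := Finset.univ)
      (t := Finset.univ.filter fun i => v i ≠ 0) r (fun i _ => by simpa using hv i) hr.injOn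
    rw [Finset.card_univ, Fintype.card_fin] at hcard
    omega

/-- The real points of the determinantal ideals over `ℤ[x]` and over `ℝ[x]` agree. -/
theorem forall_mem_detIdeal_charmatrix_aeval_eq_zero_iff {n : ℕ} (A : Matrix (Fin n) (Fin n) ℤ)
    (k : ℕ) (lam : ℝ) :
    (∀ p ∈ detIdeal A.charmatrix k, Polynomial.aeval lam p = 0) ↔
      (detIdeal (A.map (Int.cast : ℤ → ℝ)).charmatrix k).map (Polynomial.evalRingHom lam) = ⊥ := by
  have hmap : (A.map (Int.cast : ℤ → ℝ)).charmatrix =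
      A.charmatrix.map (Polynomial.mapRingHom (Int.castRingHom ℝ)) :=
    Matrix.charmatrix_map A (Int.castRingHom ℝ)
  rw [hmap, detIdeal_map, Ideal.map_map, Ideal.map_eq_bot_iff_le_ker]
  refine forall₂_congr fun p _ => ?_
  rw [RingHom.mem_ker, RingHom.comp_apply, Polynomial.coe_mapRingHom, Polynomial.coe_evalRingHom,
    Polynomial.eval_map, Polynomial.aeval_def]
  rfl

theorem Matrix.IsHermitian.detIdeal_charmatrix {n : ℕ} {M : Matrix (Fin n) (Fin n) ℝ}
    (hM : M.IsHermitian) (k : ℕ) :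
    detIdeal M.charmatrix k = detIdeal (Matrix.diagonal hM.eigenvalues).charmatrix k := by
  conv_lhs => rw [hM.spectral_theorem, Unitary.conjStarAlgAut_apply]
  exact detIdeal_charmatrix_conj (Unitary.coe_mul_star_self _) _ k

/-- At `lam`, the `k`-minors of the characteristic matrix of a real symmetric matrix all vanish if
and only if fewer than `k` eigenvalues (with multiplicity) differ from `lam`. -/
theorem Matrix.IsHermitian.map_eval_detIdeal_charmatrix_eq_bot_iff {n : ℕ}
    {M : Matrix (Fin n) (Fin n) ℝ} (hM : M.IsHermitian) (k : ℕ) (lam : ℝ) :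
    (detIdeal M.charmatrix k).map (Polynomial.evalRingHom lam) = ⊥ ↔
      (Finset.univ.filter fun i => lam ≠ hM.eigenvalues i).card < k := by
  rw [hM.detIdeal_charmatrix, ← detIdeal_map, Matrix.charmatrix_diagonal,
    Matrix.diagonal_map (map_zero _), detIdeal_diagonal_eq_bot_iff]
  simp [sub_eq_zero]

theorem Matrix.IsHermitian.eigenvalues_eq_of_card_eq {n : ℕ} {M N : Matrix (Fin n) (Fin n) ℝ}
    (hM : M.IsHermitian) (hN : N.IsHermitian)
    (h : ∀ lam : ℝ, (Finset.univ.filter fun i => lam ≠ hM.eigenvalues i).card =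
      (Finset.univ.filter fun i => lam ≠ hN.eigenvalues i).card) :
    hM.eigenvalues = hN.eigenvalues := by
  have hms : Finset.univ.val.map hM.eigenvalues = Finset.univ.val.map hN.eigenvalues := by
    ext lam
    have hM' := Finset.card_filter_add_card_filter_not (s := Finset.univ)
      fun i => lam = hM.eigenvalues i
    have hN' := Finset.card_filter_add_card_filter_not (s := Finset.univ)
      fun i => lam = hN.eigenvalues i
    have hlam := h lam
    rw [Multiset.count_map, Multiset.count_map]
    change (Finset.univ.filter fun i => lam = hM.eigenvalues i).card =
      (Finset.univ.filter fun i => lam = hN.eigenvalues i).card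
    simp only [ne_eq] at hlam
    omega
  rw [Matrix.IsHermitian.eigenvalues_eq_eigenvalues_iff, hM.charpoly_eq, hN.charpoly_eq]
  have hprod := congrArg
    (fun s => (s.map fun a : ℝ => Polynomial.X - Polynomial.C a).prod) hms
  simpa [Multiset.map_map, Finset.prod, Function.comp_def] using hprod

/-- Two symmetric integer matrices `A` and `B` are codeterminantal over `ℝ[x]`
(the ideals of `ℝ[x]` generated by the `k`-minors of `xI − A` and `xI − B` coincide for
all `1 ≤ k ≤ n`) if and only if for every such `k` the real varieties of the ideals of
`ℤ[x]` generated by the `k`-minors of `xI − A` and `xI − B` coincide. -/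
theorem codeterminantal_real_iff_varieties_eq {n : ℕ} (A B : Matrix (Fin n) (Fin n) ℤ)
    (hA : A.IsSymm) (hB : B.IsSymm) :
    (∀ k : ℕ, 1 ≤ k → k ≤ n →
        detIdeal (A.map (Int.cast : ℤ → ℝ)).charmatrix k
          = detIdeal (B.map (Int.cast : ℤ → ℝ)).charmatrix k) ↔
      (∀ k : ℕ, 1 ≤ k → k ≤ n →
        {lam : ℝ | ∀ p ∈ detIdeal A.charmatrix k, Polynomial.aeval lam p = 0}
          = {lam : ℝ | ∀ p ∈ detIdeal B.charmatrix k, Polynomial.aeval lam p = 0}) := by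
  have hA' : (A.map (Int.cast : ℤ → ℝ)).IsHermitian := by
    rw [Matrix.IsHermitian, Matrix.conjTranspose_eq_transpose_of_trivial, ← Matrix.transpose_map,
      hA.eq]
  have hB' : (B.map (Int.cast : ℤ → ℝ)).IsHermitian := by
    rw [Matrix.IsHermitian, Matrix.conjTranspose_eq_transpose_of_trivial, ← Matrix.transpose_map,
      hB.eq]
  simp only [forall_mem_detIdeal_charmatrix_aeval_eq_zero_iff]
  constructor
  · intro h k h1 hn
    rw [h k h1 hn]
  · intro h k _ _
    rw [hA'.detIdeal_charmatrix, hB'.detIdeal_charmatrix,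
      hA'.eigenvalues_eq_of_card_eq hB' fun lam => ?_]
    have hiff : ∀ j : ℕ, 1 ≤ j → j ≤ n →
        ((Finset.univ.filter fun i => lam ≠ hA'.eigenvalues i).card < j ↔
          (Finset.univ.filter fun i => lam ≠ hB'.eigenvalues i).card < j) := fun j h1 hn => by
      rw [← hA'.map_eval_detIdeal_charmatrix_eq_bot_iff,
        ← hB'.map_eval_detIdeal_charmatrix_eq_bot_iff]
      exact Set.ext_iff.1 (h j h1 hn) lam
    have hcA := Finset.card_le_univ (Finset.univ.filter fun i => lam ≠ hA'.eigenvalues i)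
    have hcB := Finset.card_le_univ (Finset.univ.filter fun i => lam ≠ hB'.eigenvalues i)
    rw [Fintype.card_fin] at hcA hcB
    rcases lt_trichotomy (Finset.univ.filter fun i => lam ≠ hA'.eigenvalues i).card
      (Finset.univ.filter fun i => lam ≠ hB'.eigenvalues i).card with hlt | heq | hlt
    · exact absurd ((hiff _ (by omega) hcB).1 hlt) (lt_irrefl _)
    · exact heq
    · exact absurd ((hiff _ (by omega) hcA).2 hlt) (lt_irrefl _)
end

section
/- Let G and G' be connected simple graphs on the same finite vertex set V with |V| = n. Then G and G' are isomorphic if and only if there exists a permutation σ of V such that det D_X(G) = rename_σ(det D_X(G')), where rename_σ is the ℤ-algebra automorphism of the multivariate polynomial ring ℤ[x_u : u ∈ V] sending x_u to x_{σ(u)}. -/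
/-- The generalized distance matrix `D_X(G)` of a (connected) graph `G`: the matrix over
`ℤ[x_u : u ∈ V]` with `(u,u)` entry the indeterminate `x_u` and `(u,v)` entry
`−dist_G(u,v)` for `u ≠ v`. -/
noncomputable def DX {V : Type*} [Fintype V] [DecidableEq V] (G : SimpleGraph V) :
    Matrix V V (MvPolynomial V ℤ) :=
  fun u v => if u = v then MvPolynomial.X u else -(G.dist u v : MvPolynomial V ℤ)

/-- A graph homomorphism does not increase the distance between two reachable vertices. -/
theorem SimpleGraph.Hom.dist_map_le {V W : Type*} {G : SimpleGraph V} {H : SimpleGraph W}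
    (f : G →g H) {u v : V} (h : G.Reachable u v) : H.dist (f u) (f v) ≤ G.dist u v := by
  obtain ⟨p, hp⟩ := h.exists_walk_length_eq_dist
  rw [← hp, ← SimpleGraph.Walk.length_map f p]
  exact SimpleGraph.dist_le _

/-- A graph isomorphism preserves distances. -/
theorem SimpleGraph.Iso.dist_map {V W : Type*} {G : SimpleGraph V} {H : SimpleGraph W}
    (φ : G ≃g H) (u v : V) : H.dist (φ u) (φ v) = G.dist u v := by
  by_cases h : G.Reachable u v
  · refine le_antisymm (φ.toHom.dist_map_le h) ?_
    simpa using φ.symm.toHom.dist_map_le (φ.reachable_iff.mpr h)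
  · rw [SimpleGraph.dist_eq_zero_of_not_reachable h,
      SimpleGraph.dist_eq_zero_of_not_reachable (mt φ.reachable_iff.mp h)]

section

open MvPolynomial

variable {V : Type*} [Fintype V] [DecidableEq V]

/-- An isomorphism carries the generalized distance determinant of one graph to the other,
after renaming the indeterminates accordingly. -/
theorem rename_det_DX {G H : SimpleGraph V} (φ : G ≃g H) :
    rename φ (DX G).det = (DX H).det := by
  rw [AlgHom.map_det, ← Matrix.det_submatrix_equiv_self φ.toEquiv (DX H)]
  congr 1
  ext1 u v
  by_cases h : u = v <;> simp [DX, h, φ.dist_map]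

/-- The exponent of the squarefree monomial supported on the fixed points of `σ`. -/
noncomputable def fixedPointExponent (σ : Equiv.Perm V) : V →₀ ℕ :=
  ∑ i, if σ i = i then Finsupp.single i 1 else 0

theorem fixedPointExponent_apply (σ : Equiv.Perm V) (i : V) :
    fixedPointExponent σ i = if σ i = i then 1 else 0 := by
  rw [fixedPointExponent, Finsupp.finsetSum_apply, Finset.sum_eq_single i]
  · split_ifs <;> simp
  · intro j _ hj
    split_ifs <;> simp [hj]
  · simp

/-- A transposition is determined by its fixed points. -/
theorem fixedPointExponent_eq_swap_iff {σ : Equiv.Perm V} {u v : V} :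
    fixedPointExponent σ = fixedPointExponent (Equiv.swap u v) ↔ σ = Equiv.swap u v := by
  refine ⟨fun h ↦ ?_, congrArg _⟩
  have hfix (i : V) : σ i = i ↔ Equiv.swap u v i = i := by
    have := DFunLike.congr_fun h i
    simp only [fixedPointExponent_apply] at this
    split_ifs at this <;> simp_all
  have hσ := fun i ↦ hfix (σ i)
  simp only [σ.injective.eq_iff] at hσ
  ext i
  have h₁ := hfix i
  have h₂ := hσ i
  simp only [Equiv.swap_apply_def] at h₁ h₂ ⊢
  grind

/-- The term of the Leibniz expansion of `det D_X(G)` indexed by `σ`. -/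
theorem prod_DX_eq_monomial (G : SimpleGraph V) (σ : Equiv.Perm V) :
    ∏ i, DX G (σ i) i =
      monomial (fixedPointExponent σ) (∏ i, if σ i = i then 1 else -(G.dist (σ i) i : ℤ)) := by
  rw [fixedPointExponent, monomial_sum_prod]
  refine Finset.prod_congr rfl fun i _ ↦ ?_
  by_cases h : σ i = i
  · simp [DX, h, X]
  · simp only [DX, h, if_false]
    rw [← C_apply]
    simp

/-- The coefficient of `∏_{w ≠ u, v} x_w` in `det D_X(G)` is `-dist(u, v)²`. -/
theorem coeff_det_DX (G : SimpleGraph V) {u v : V} (huv : u ≠ v) :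
    coeff (fixedPointExponent (Equiv.swap u v)) (DX G).det = -(G.dist u v : ℤ) ^ 2 := by
  have hprod : (∏ i, if Equiv.swap u v i = i then 1 else -(G.dist (Equiv.swap u v i) i : ℤ)) =
      (G.dist u v : ℤ) ^ 2 := by
    rw [Fintype.prod_eq_mul u v huv]
    · simp [huv, huv.symm, G.dist_comm (u := v), sq]
    · rintro i ⟨hu, hv⟩
      simp [Equiv.swap_apply_of_ne_of_ne hu hv]
  simp_rw [Matrix.det_apply, prod_DX_eq_monomial, coeff_sum, Units.smul_def, coeff_smul,
    coeff_monomial, fixedPointExponent_eq_swap_iff]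
  rw [Fintype.sum_eq_single (Equiv.swap u v) fun σ hσ ↦ by rw [if_neg hσ, smul_zero], if_pos rfl,
    hprod, Equiv.Perm.sign_swap huv]
  simp

/-- The generalized distance determinant determines the graph. -/
theorem eq_of_det_DX_eq {G H : SimpleGraph V} (h : (DX G).det = (DX H).det) : G = H := by
  ext u v
  obtain rfl | huv := eq_or_ne u v
  · simp
  have hd := congrArg (coeff (fixedPointExponent (Equiv.swap u v))) h
  rw [coeff_det_DX G huv, coeff_det_DX H huv, neg_inj,
    sq_eq_sq₀ (Nat.cast_nonneg _) (Nat.cast_nonneg _), Nat.cast_inj] at hd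
  rw [← SimpleGraph.dist_eq_one_iff_adj, hd, SimpleGraph.dist_eq_one_iff_adj]

end

/-- Two connected graphs `G` and `G'` on the same vertex set are isomorphic if and only
if there is a permutation `σ` of the vertices with
`det D_X(G) = rename_σ (det D_X(G'))`. -/
theorem isomorphic_iff_det_DX_eq {V : Type*} [Fintype V] [DecidableEq V]
    (G G' : SimpleGraph V) (hG : G.Connected) (hG' : G'.Connected) :
    Nonempty (G ≃g G') ↔
      ∃ σ : Equiv.Perm V,
        (DX G).det = MvPolynomial.rename σ ((DX G').det) := by
  constructor
  · rintro ⟨φ⟩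
    exact ⟨φ.symm.toEquiv, (rename_det_DX φ.symm).symm⟩
  · rintro ⟨σ, hσ⟩
    rw [eq_of_det_DX_eq (hσ.trans (rename_det_DX (SimpleGraph.Iso.map σ G')))]
    exact ⟨(SimpleGraph.Iso.map σ G').symm⟩
end

section
/- Let G and G' be simple graphs on the same finite vertex set V with |V| = n. Then G and G' are isomorphic if and only if there exists a permutation σ of V such that the n-th critical ideals of G and of the relabeled G' are equal, i.e. the ideal of ℤ[x_u : u ∈ V] generated by det A_X(G) equals the ideal generated by rename_σ(det A_X(G')), where rename_σ is the ℤ-algebra automorphism of ℤ[x_u : u ∈ V] sending x_u to x_{σ(u)}. -/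
open Classical in
/-- The generalized adjacency matrix `A_X(G)` of a graph `G`: the matrix over
`ℤ[x_u : u ∈ V]` with `(u,u)` entry the indeterminate `x_u`, and `(u,v)` entry `−1` if
`u ∼ v` and `0` otherwise. -/
noncomputable def AX {V : Type*} [Fintype V] [DecidableEq V] (G : SimpleGraph V) :
    Matrix V V (MvPolynomial V ℤ) :=
  fun u v => if u = v then MvPolynomial.X u else if G.Adj u v then -1 else 0

open MvPolynomial Equiv

lemma sum_single_one_injective {V : Type*} [DecidableEq V] :
    Function.Injective fun s : Finset V => ∑ i ∈ s, Finsupp.single i 1 := by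
  intro s t h
  ext a
  have := DFunLike.congr_fun h a
  simp only [Finsupp.finsetSum_apply, Finsupp.single_apply, Finset.sum_ite_eq'] at this
  split_ifs at this <;> simp_all

section

variable {V : Type*} [Fintype V] [DecidableEq V]

open Classical in
lemma prod_AX_perm (G : SimpleGraph V) (σ : Perm V) :
    ∏ i, AX G (σ i) i = monomial (∑ i ∈ σ.supportᶜ, Finsupp.single i 1)
      (∏ i ∈ σ.support, if G.Adj (σ i) i then (-1 : ℤ) else 0) := by
  rw [← Finset.prod_mul_prod_compl σ.support, ← mul_one (Finset.prod _ fun i => ite _ _ _),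
    ← C_mul_monomial, monomial_sum_one, map_prod]
  congr 1
  · refine Finset.prod_congr rfl fun i hi => ?_
    rw [AX, if_neg (Perm.mem_support.1 hi)]
    split_ifs <;> simp
  · refine Finset.prod_congr rfl fun i hi => ?_
    have hi : σ i = i := by simpa using hi
    simp [AX, hi, X]

open Classical in
/-- The coefficient of a squarefree monomial in `det A_X(G)` is a signed sum over the permutations
moving exactly the remaining vertices. -/
lemma coeff_det_AX (G : SimpleGraph V) (s : Finset V) :
    coeff (∑ i ∈ sᶜ, Finsupp.single i 1) (AX G).det =
      ∑ σ : Perm V with σ.support = s,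
        (Perm.sign σ : ℤ) * ∏ i ∈ σ.support, if G.Adj (σ i) i then (-1 : ℤ) else 0 := by
  rw [Matrix.det_apply', coeff_sum, Finset.sum_filter]
  refine Finset.sum_congr rfl fun σ _ => ?_
  rw [prod_AX_perm, ← map_intCast (C : ℤ →+* MvPolynomial V ℤ), coeff_C_mul, coeff_monomial]
  simp only [sum_single_one_injective.eq_iff (a := σ.supportᶜ), compl_inj_iff]
  simp

lemma coeff_univ_det_AX (G : SimpleGraph V) :
    coeff (∑ i, Finsupp.single i 1) (AX G).det = 1 := by
  have h : (Finset.univ.filter fun σ : Perm V => σ.support = ∅) = {1} := by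
    ext σ
    simp
  rw [← Finset.compl_empty, coeff_det_AX, h]
  simp

lemma support_eq_pair_iff {u v : V} (huv : u ≠ v) (σ : Perm V) :
    σ.support = {u, v} ↔ σ = swap u v := by
  refine ⟨fun h => ?_, fun h => h ▸ Perm.support_swap huv⟩
  obtain ⟨x, y, hxy, rfl⟩ := Perm.card_support_eq_two.1 (h ▸ Finset.card_pair huv)
  rw [Perm.support_swap hxy, ← Finset.coe_inj] at h
  push_cast at h
  obtain ⟨rfl, rfl⟩ | ⟨rfl, rfl⟩ := Set.pair_eq_pair_iff.1 h
  · rfl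
  · exact swap_comm _ _

open Classical in
lemma coeff_pair_det_AX (G : SimpleGraph V) {u v : V} (huv : u ≠ v) :
    coeff (∑ i ∈ {u, v}ᶜ, Finsupp.single i 1) (AX G).det = if G.Adj u v then -1 else 0 := by
  have h : (Finset.univ.filter fun σ : Perm V => σ.support = {u, v}) = {swap u v} := by
    ext σ
    simp [support_eq_pair_iff huv]
  rw [coeff_det_AX, h, Finset.sum_singleton, Perm.support_swap huv, Finset.prod_pair huv,
    Perm.sign_swap huv, swap_apply_left, swap_apply_right, G.adj_comm v u]
  split_ifs <;> simp

lemma det_AX_injective : Function.Injective fun G : SimpleGraph V => (AX G).det := by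
  classical
  intro G H h
  ext u v
  by_cases huv : u = v
  · simp [huv]
  · have := congrArg (coeff (∑ i ∈ {u, v}ᶜ, Finsupp.single i 1)) h
    simp only [coeff_pair_det_AX _ huv] at this
    split_ifs at this <;> simp_all

lemma span_det_AX_injective :
    Function.Injective fun G : SimpleGraph V => Ideal.span {(AX G).det} := by
  intro G H h
  obtain ⟨w, hw⟩ := Ideal.span_singleton_eq_span_singleton.1 h
  obtain ⟨c, -, hc⟩ := isUnit_iff_eq_C_of_isReduced.1 w.isUnit
  have h1 := congrArg (coeff (∑ i, Finsupp.single i 1)) hw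
  rw [hc, mul_comm, coeff_C_mul, coeff_univ_det_AX, coeff_univ_det_AX, mul_one] at h1
  apply det_AX_injective
  simpa [hc, h1] using hw

lemma rename_det_AX (G : SimpleGraph V) (σ : Perm V) :
    rename σ (AX G).det = (AX (G.comap σ.symm)).det := by
  rw [AlgHom.map_det, ← Matrix.det_submatrix_equiv_self σ (AX (G.comap σ.symm))]
  congr 1
  ext1 u v
  simp only [AlgHom.mapMatrix_apply, Matrix.map_apply, Matrix.submatrix_apply, AX,
    EmbeddingLike.apply_eq_iff_eq]
  split_ifs <;> simp_all

end

/-- Two graphs `G` and `G'` on the same vertex set of size `n` are isomorphic if and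
only if there is a permutation `σ` of the vertices such that the `n`-th critical ideals
of `G` and of the relabeled `G'` are equal, i.e. the ideals of `ℤ[x_u : u ∈ V]`
generated by `det A_X(G)` and by `rename_σ (det A_X(G'))` coincide. -/
theorem isomorphic_iff_nth_critical_ideal_eq {V : Type*} [Fintype V] [DecidableEq V]
    (G G' : SimpleGraph V) :
    Nonempty (G ≃g G') ↔
      ∃ σ : Equiv.Perm V,
        Ideal.span {(AX G).det}
          = Ideal.span {MvPolynomial.rename σ ((AX G').det)} := by
  simp only [rename_det_AX, span_det_AX_injective.eq_iff]
  constructor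
  · rintro ⟨f⟩
    refine ⟨f.toEquiv.symm, ?_⟩
    ext u v
    exact f.map_adj_iff.symm
  · rintro ⟨σ, rfl⟩
    exact ⟨SimpleGraph.Iso.comap σ.symm G'⟩
end

section
/- Let n ≥ 2 and let K_n be the complete graph on n vertices with adjacency matrix A(K_n) (over ℤ). Then in ℤ[x]: for every k with 1 ≤ k ≤ n−1, the ideal generated by the k-minors of xI_n − A(K_n) equals the principal ideal ⟨(x+1)^{k−1}⟩, and the ideal generated by the n-minors equals the principal ideal ⟨(x+1−n)(x+1)^{n−1}⟩. -/
/-- The adjacency matrix of the complete graph `K_n`: `(i,j)` entry `1` if `i ≠ j`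
and `0` if `i = j`. -/
def adjKn (n : ℕ) : Matrix (Fin n) (Fin n) ℤ :=
  fun i j => if i = j then 0 else 1

open Polynomial in
theorem charmatrix_adjKn_apply (n : ℕ) (i j : Fin n) :
    (adjKn n).charmatrix i j = (X + 1) * (if i = j then 1 else 0) - 1 := by
  by_cases h : i = j <;> simp [adjKn, h]

theorem det_mul_sub_one {R : Type*} [CommRing R] {m : ℕ} (y : R)
    (B : Fin (m + 1) → Fin (m + 1) → R) :
    (Matrix.of fun i j => y * B i j - 1).det =
      y ^ m * (Matrix.of fun i j => if i = 0 then y * B 0 j - 1 else B i j - B 0 j).det := by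
  have hprod : ∏ i : Fin (m + 1), (if i = 0 then 1 else y) = y ^ m := by
    simp [Fin.prod_univ_succ]
  rw [← hprod, ← Matrix.det_mul_column]
  refine Matrix.det_eq_of_forall_row_eq_smul_add_const (fun i => if i = 0 then 0 else 1) 0
    (by simp) fun i j => ?_
  by_cases h : i = 0
  · simp [h]
  · simp only [Matrix.of_apply, h, if_true, if_false]
    ring

open Polynomial in
theorem pow_dvd_det_submatrix_charmatrix_adjKn {n m : ℕ} (r c : Fin (m + 1) → Fin n) :
    (X + 1 : ℤ[X]) ^ m ∣ ((adjKn n).charmatrix.submatrix r c).det := by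
  have h : (adjKn n).charmatrix.submatrix r c =
      Matrix.of fun i j => (X + 1 : ℤ[X]) * (if r i = c j then 1 else 0) - 1 := by
    ext1 i j
    exact charmatrix_adjKn_apply n (r i) (c j)
  rw [h, det_mul_sub_one (X + 1 : ℤ[X]) (fun i j => if r i = c j then 1 else 0)]
  exact dvd_mul_right _ _

open Polynomial in
theorem exists_det_submatrix_charmatrix_adjKn {n m : ℕ} (h : m + 1 < n) :
    ∃ r c : Fin (m + 1) → Fin n, Function.Injective r ∧ Function.Injective c ∧
      ((adjKn n).charmatrix.submatrix r c).det = -(X + 1 : ℤ[X]) ^ m := by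
  let r : Fin (m + 1) → Fin n := fun i => ⟨i, by omega⟩
  let c : Fin (m + 1) → Fin n := fun j => if j = 0 then ⟨m + 1, h⟩ else ⟨j, by omega⟩
  have hr : Function.Injective r := fun i j hij => by
    simpa [r, Fin.ext_iff] using hij
  have hc : Function.Injective c := fun i j hij => by
    simp only [c] at hij
    split_ifs at hij <;> simp only [Fin.ext_iff, Fin.coe_ofNat_eq_mod, Nat.zero_mod] at * <;> omega
  have hB (i j : Fin (m + 1)) : r i = c j ↔ i = j ∧ j ≠ 0 := by
    simp only [r, c]
    split_ifs <;> simp only [Fin.ext_iff, Fin.coe_ofNat_eq_mod, Nat.zero_mod, ne_eq] at * <;> omega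
  refine ⟨r, c, hr, hc, ?_⟩
  have hM : (adjKn n).charmatrix.submatrix r c =
      Matrix.of fun i j => (X + 1 : ℤ[X]) * (if i = j ∧ j ≠ 0 then 1 else 0) - 1 := by
    ext1 i j
    simp only [← hB]
    exact charmatrix_adjKn_apply n (r i) (c j)
  rw [hM, det_mul_sub_one (X + 1 : ℤ[X]) (fun i j => if i = j ∧ j ≠ 0 then 1 else 0),
    Matrix.det_of_isUpperTriangular]
  · simp [Fin.prod_univ_succ, (Fin.succ_ne_zero _).symm]
  · intro i j hij
    have hi : i ≠ 0 := Fin.ne_zero_of_lt hij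
    have h0 : ¬ (0 = j ∧ j ≠ 0) := fun h => h.2 h.1.symm
    have hne : i ≠ j := ne_of_gt hij
    simp [hi, h0, hne]

open Polynomial in
theorem det_charmatrix_adjKn {n : ℕ} (hn : n ≠ 0) :
    (adjKn n).charmatrix.det = (X + 1 - (n : ℤ[X])) * (X + 1) ^ (n - 1) := by
  have h : (adjKn n).charmatrix =
      Matrix.scalar (Fin n) (X + 1 : ℤ[X]) - Matrix.vecMulVec 1 1 := by
    ext1 i j
    rw [charmatrix_adjKn_apply]
    by_cases hij : i = j <;> simp [hij]
  obtain ⟨m, rfl⟩ := Nat.exists_eq_succ_of_ne_zero hn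
  rw [h, ← Matrix.eval_charpoly, Matrix.charpoly_vecMulVec]
  simp only [eval_sub, eval_pow, eval_X, eval_smul, Fintype.card_fin, one_dotProduct_one,
    smul_eq_mul, Nat.succ_sub_one, Nat.succ_eq_add_one]
  ring

theorem detIdeal_self {R : Type*} [CommRing R] {n : ℕ} (M : Matrix (Fin n) (Fin n) R) :
    detIdeal M n = Ideal.span {M.det} := by
  refine le_antisymm (Ideal.span_le.2 ?_) (Ideal.span_mono ?_)
  · rintro _ ⟨r, c, hr, hc, rfl⟩
    rw [SetLike.mem_coe, Ideal.mem_span_singleton]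
    let σ := Equiv.ofBijective r (Finite.injective_iff_bijective.1 hr)
    let τ := Equiv.ofBijective c (Finite.injective_iff_bijective.1 hc)
    have h : M.submatrix r c = (M.submatrix σ id).submatrix id τ := rfl
    rw [h, Matrix.det_permute', Matrix.det_permute]
    exact ((dvd_refl _).mul_left _).mul_left _
  · rintro _ rfl
    exact ⟨id, id, Function.injective_id, Function.injective_id, by simp⟩

/-- The characteristic ideals of the complete graph `K_n` over `ℤ[x]`:
`I_k(xI − A(K_n)) = ⟨(x+1)^{k−1}⟩` for `1 ≤ k ≤ n − 1`, and
`I_n(xI − A(K_n)) = ⟨(x+1−n)(x+1)^{n−1}⟩`. -/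
theorem charIdeals_completeGraph (n : ℕ) (hn : 2 ≤ n) :
    (∀ k : ℕ, 1 ≤ k → k ≤ n - 1 →
        detIdeal (adjKn n).charmatrix k
          = Ideal.span {(Polynomial.X + 1: Polynomial ℤ) ^ (k - 1)}) ∧
      detIdeal (adjKn n).charmatrix n
        = Ideal.span {(Polynomial.X + 1 - (n : Polynomial ℤ))
            * (Polynomial.X + 1) ^ (n - 1)} := by
  refine ⟨fun k hk hkn => ?_, by rw [detIdeal_self, det_charmatrix_adjKn (by omega)]⟩
  obtain ⟨m, rfl⟩ := Nat.exists_eq_add_of_le' hk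
  refine le_antisymm (Ideal.span_le.2 ?_) ?_
  · rintro _ ⟨r, c, -, -, rfl⟩
    exact Ideal.mem_span_singleton.2 (pow_dvd_det_submatrix_charmatrix_adjKn r c)
  · obtain ⟨r, c, hr, hc, h⟩ := exists_det_submatrix_charmatrix_adjKn (n := n) (m := m) (by omega)
    rw [Ideal.span_singleton_le_iff_mem, ← neg_mem_iff]
    exact Ideal.subset_span ⟨r, c, hr, hc, h.symm⟩
end

section
/- Let n ≥ 2 and let L(K_n) = (n−1)I_n − A(K_n) be the Laplacian matrix of the complete graph K_n (an integer matrix with diagonal entries n−1 and off-diagonal entries −1). Then for every k with 1 ≤ k ≤ n−1, the ideal of ℤ generated by the k-minors of L(K_n) equals the principal ideal ⟨n^{k−1}⟩, and the ideal generated by the n-minors of L(K_n) equals the zero ideal. Consequently the Smith normal form of L(K_n) is diag(1, n, …, n, 0), so the sandpile (critical) group of K_n is isomorphic to (ℤ/nℤ)^{n−2}. -/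
/-- The Laplacian matrix of the complete graph `K_n`: diagonal entries `n − 1`,
off-diagonal entries `−1`. -/
def lapKn (n : ℕ) : Matrix (Fin n) (Fin n) ℤ :=
  fun i j => if i = j then (n : ℤ) - 1 else -1

lemma lapKn_apply (n : ℕ) (i j : Fin n) :
    lapKn n i j = n * (if i = j then 1 else 0) - 1 := by
  unfold lapKn
  split_ifs <;> ring

lemma lapKn_mulVec (n : ℕ) (v : Fin n → ℤ) (i : Fin n) :
    (lapKn n).mulVec v i = n * v i - ∑ j, v j := by
  simp [Matrix.mulVec, dotProduct, lapKn_apply, sub_mul, Finset.sum_sub_distrib]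

/-- A matrix which becomes divisible by `a` after adding the all-ones matrix has determinant
divisible by `a ^ k`, where `k + 1` is its size. -/
lemma pow_dvd_det_smul_sub_one {R : Type*} [CommRing R] {k : ℕ} (a : R)
    (P : Matrix (Fin (k + 1)) (Fin (k + 1)) R) :
    a ^ k ∣ (Matrix.of fun i j => a * P i j - 1).det := by
  have h : (Matrix.of fun i j => a * P i j - 1).det =
      (Matrix.of fun i j => (Fin.cons 1 (fun _ => a) : Fin (k + 1) → R) i *
        (Fin.cons (fun j => a * P 0 j - 1) (fun i j => P i.succ j - P 0 j) :
          Fin (k + 1) → Fin (k + 1) → R) i j).det := by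
    refine Matrix.det_eq_of_forall_row_eq_smul_add_const (Fin.cons 0 fun _ => 1) 0 (by simp) ?_
    intro i j
    refine Fin.cases ?_ (fun i => ?_) i
    · simp
    · simp
      ring
  have h' := Matrix.det_mul_column (Fin.cons 1 (fun _ => a) : Fin (k + 1) → R)
    (Matrix.of (Fin.cons (fun j => a * P 0 j - 1) (fun i j => P i.succ j - P 0 j) :
          Fin (k + 1) → Fin (k + 1) → R))
  simp only [Matrix.of_apply] at h'
  rw [h, h', Fin.prod_univ_succ]
  simp

lemma pow_dvd_det_submatrix_lapKn {n k : ℕ} (r c : Fin (k + 1) → Fin n) :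
    (n : ℤ) ^ k ∣ ((lapKn n).submatrix r c).det := by
  have h : (lapKn n).submatrix r c =
      Matrix.of fun i j => (n : ℤ) * (if r i = c j then 1 else 0) - 1 := by
    ext i j
    exact lapKn_apply n (r i) (c j)
  rw [h]
  exact pow_dvd_det_smul_sub_one (n : ℤ) _

lemma exists_det_submatrix_lapKn {n k : ℕ} (hk : k + 1 < n) :
    ∃ r c : Fin (k + 1) → Fin n, Function.Injective r ∧ Function.Injective c ∧
      ((lapKn n).submatrix r c).det = -(n : ℤ) ^ k := by
  refine ⟨Fin.castLE hk.le,
    Fin.cons ⟨k + 1, hk⟩ (fun j => Fin.castLE hk.le j.succ), Fin.castLE_injective _, ?_, ?_⟩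
  · rw [Fin.cons_injective_iff]
    refine ⟨?_, (Fin.castLE_injective _).comp (Fin.succ_injective _)⟩
    rintro ⟨j, hj⟩
    have := congrArg Fin.val hj
    simp at this
    omega
  · have h : ((lapKn n).submatrix (Fin.castLE hk.le)
        (Fin.cons ⟨k + 1, hk⟩ (fun j => Fin.castLE hk.le j.succ))).det =
        (Matrix.of fun i j : Fin (k + 1) => if j = 0 then (-1 : ℤ) else
          if i = j then (n : ℤ) else 0).det := by
      rw [← Matrix.det_transpose, ← Matrix.det_transpose (Matrix.of _)]
      refine Matrix.det_eq_of_forall_row_eq_smul_add_const (Fin.cons 0 fun _ => 1) 0 (by simp) ?_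
      intro j i
      refine Fin.cases ?_ (fun j => ?_) j
      · have : Fin.castLE hk.le i ≠ ⟨k + 1, hk⟩ := by
          intro h
          have := congrArg Fin.val h
          simp at this
          omega
        simp [lapKn_apply, this]
      · simp [lapKn_apply, sub_eq_add_neg]
    rw [h, Matrix.det_of_isLowerTriangular]
    · simp [Fin.prod_univ_succ]
    · intro i j hij
      have hij : i < j := hij
      simp [hij.ne, (Fin.zero_le i).trans_lt hij |>.ne']

lemma detIdeal_lapKn {n k : ℕ} (hk : k + 1 < n) :
    detIdeal (lapKn n) (k + 1) = Ideal.span {(n : ℤ) ^ k} := by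
  apply le_antisymm
  · refine Ideal.span_le.2 ?_
    rintro _ ⟨r, c, -, -, rfl⟩
    exact Ideal.mem_span_singleton.2 (pow_dvd_det_submatrix_lapKn r c)
  · obtain ⟨r, c, hr, hc, h⟩ := exists_det_submatrix_lapKn hk
    rw [Ideal.span_singleton_le_iff_mem, ← neg_mem_iff, ← h]
    exact Ideal.subset_span ⟨r, c, hr, hc, rfl⟩

lemma detIdeal_lapKn_self {n : ℕ} (hn : 0 < n) : detIdeal (lapKn n) n = ⊥ := by
  refine Ideal.span_eq_bot.2 ?_
  rintro _ ⟨r, c, -, hc, rfl⟩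
  refine Matrix.exists_mulVec_eq_zero_iff.1 ⟨1, fun h => ?_, ?_⟩
  · simpa using congrFun h ⟨0, hn⟩
  · ext i
    have h := lapKn_mulVec n 1 (r i)
    simp only [Matrix.mulVec, dotProduct] at h ⊢
    rw [Matrix.submatrix]
    simpa using ((Finite.injective_iff_bijective.1 hc).sum_comp
      (fun j => lapKn n (r i) j)).trans (by simpa using h)

/-- The map `x ↦ ((x_{i+1} - x_0 mod (m + 2))_{i < m}, ∑ x_i)`, which identifies the cokernel of the
Laplacian of `K_{m+2}`. -/
def lapKnCokernelMap (m : ℕ) :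
    (Fin (m + 2) → ℤ) →ₗ[ℤ] (Fin m → ZMod (m + 2)) × ℤ :=
  (AddMonoidHom.mk' (fun x => (fun i => ((x i.castSucc.succ - x 0 : ℤ) : ZMod (m + 2)), ∑ i, x i))
    (fun x y => by
      refine Prod.ext ?_ ?_
      · ext i
        simp
        ring
      · simp [Finset.sum_add_distrib])).toIntLinearMap

lemma lapKnCokernelMap_apply (m : ℕ) (x : Fin (m + 2) → ℤ) :
    lapKnCokernelMap m x =
      (fun i => ((x i.castSucc.succ - x 0 : ℤ) : ZMod (m + 2)), ∑ i, x i) := rfl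

lemma lapKnCokernelMap_surjective (m : ℕ) : Function.Surjective (lapKnCokernelMap m) := by
  rintro ⟨d, s⟩
  choose e he using fun i => ZMod.intCast_surjective (d i)
  refine ⟨Fin.cons 0 (Fin.snoc e (s - ∑ i, e i) : Fin (m + 1) → ℤ), ?_⟩
  rw [lapKnCokernelMap_apply]
  refine Prod.ext ?_ ?_
  · ext i
    simp [he]
  · simp [Fin.sum_univ_succ, Fin.sum_univ_castSucc (n := m)]

lemma ker_lapKnCokernelMap (m : ℕ) :
    LinearMap.ker (lapKnCokernelMap m) = LinearMap.range (Matrix.toLin' (lapKn (m + 2))) := by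
  ext x
  rw [LinearMap.mem_ker, LinearMap.mem_range, lapKnCokernelMap_apply, Prod.mk_eq_zero]
  constructor
  · rintro ⟨hd, hs⟩
    have hdvd (i : Fin m) : ((m + 2 : ℕ) : ℤ) ∣ x i.castSucc.succ - x 0 :=
      (ZMod.intCast_zmod_eq_zero_iff_dvd _ _).1 (congrFun hd i)
    choose t ht using hdvd
    have hx (i : Fin m) : x i.castSucc.succ = x 0 + (m + 2 : ℕ) * t i := by linarith [ht i]
    refine ⟨Fin.cons 0 (Fin.snoc t (-x 0 - ∑ i, t i) : Fin (m + 1) → ℤ), ?_⟩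
    rw [Fin.sum_univ_succ, Fin.sum_univ_castSucc] at hs
    simp only [hx, Finset.sum_add_distrib, ← Finset.mul_sum] at hs
    ext i
    rw [Matrix.toLin'_apply, lapKn_mulVec, Fin.sum_univ_succ, Fin.sum_univ_castSucc]
    refine Fin.cases ?_ (fun i => ?_) i
    · simp
    · refine Fin.lastCases ?_ (fun i => ?_) i
      · simp at hs ⊢
        linarith
      · simp [hx]
        ring
  · rintro ⟨y, rfl⟩
    simp only [Matrix.toLin'_apply, lapKn_mulVec]
    refine ⟨?_, by simp [Finset.sum_sub_distrib, ← Finset.mul_sum]⟩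
    ext i
    refine (ZMod.intCast_zmod_eq_zero_iff_dvd _ (m + 2)).2
      ⟨y i.castSucc.succ - y 0, ?_⟩
    ring

/-- For the Laplacian of `K_n`: `I_k^ℤ(L(K_n)) = ⟨n^{k−1}⟩` for `1 ≤ k ≤ n − 1`, and
`I_n^ℤ(L(K_n)) = ⟨0⟩`. Consequently the Smith normal form of `L(K_n)` is
`diag(1, n, …, n, 0)`, so the sandpile (critical) group of `K_n`, the torsion part of
the cokernel of `L(K_n)`, is `(ℤ/nℤ)^{n−2}` (the cokernel being `(ℤ/nℤ)^{n−2} × ℤ`). -/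
theorem detIdeals_lap_completeGraph (n : ℕ) (hn : 2 ≤ n) :
    (∀ k : ℕ, 1 ≤ k → k ≤ n - 1 →
        detIdeal (lapKn n) k = Ideal.span {(n : ℤ) ^ (k - 1)}) ∧
      detIdeal (lapKn n) n = ⊥ ∧
      Nonempty (((Fin n → ℤ) ⧸ LinearMap.range (Matrix.toLin' (lapKn n)))
        ≃+ ((Fin (n - 2) → ZMod n) × ℤ)) := by
  refine ⟨?_, detIdeal_lapKn_self (by omega), ?_⟩
  · intro k hk hkn
    obtain ⟨k, rfl⟩ := Nat.exists_eq_add_of_le' hk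
    exact detIdeal_lapKn (by omega)
  · obtain ⟨m, rfl⟩ := Nat.exists_eq_add_of_le' hn
    exact ⟨((Submodule.quotEquivOfEq _ _ (ker_lapKnCokernelMap m).symm).trans
      ((lapKnCokernelMap m).quotKerEquivOfSurjective
        (lapKnCokernelMap_surjective m))).toAddEquiv⟩
end

section
/- Star graphs are determined by the Smith normal form of their distance Laplacian matrix: let n ≥ 2 and let G be a connected simple graph on n vertices such that for every k with 1 ≤ k ≤ n the ideal of ℤ generated by the k-minors of the distance Laplacian matrix F(G) equals the ideal generated by the k-minors of F(K_{1,n−1}), where K_{1,n−1} is the star graph on n vertices (equivalently, F(G) and F(K_{1,n−1}) have the same Smith normal form). Then G is isomorphic to the star graph K_{1,n−1}. -/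
/-- The distance Laplacian matrix `F(G) = T(G) − D(G)` of a graph `G` on `Fin n`:
the `(u,u)` entry is the transmission `∑ w, dist_G(u,w)` and the `(u,v)` entry for
`u ≠ v` is `−dist_G(u,v)`. -/
noncomputable def distLap {n : ℕ} (G : SimpleGraph (Fin n)) :
    Matrix (Fin n) (Fin n) ℤ :=
  fun u v => if u = v then ∑ w, (G.dist u w : ℤ) else -(G.dist u v : ℤ)

/-- The star graph `K_{1,n−1}` on `Fin n`: vertex `0` is adjacent to all other vertices,
which are pairwise nonadjacent. -/
def starGraph (n : ℕ) : SimpleGraph (Fin n) :=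
  SimpleGraph.fromRel (fun u _ => u.val = 0)

/-- The determinantal ideals of a matrix of the form `a * bᵀ` modulo `m` are divisible by `m`
from the second one on. -/
lemma detIdeal_two_le_span {n : ℕ} (M : Matrix (Fin n) (Fin n) ℤ) (m : ℤ) (a b : Fin n → ℤ)
    (hM : ∀ i j, m ∣ M i j - a i * b j) : detIdeal M 2 ≤ Ideal.span {m} := by
  refine Ideal.span_le.2 ?_
  rintro d ⟨r, c, -, -, rfl⟩
  rw [SetLike.mem_coe, Ideal.mem_span_singleton, Matrix.det_fin_two]
  simp only [Matrix.submatrix_apply]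
  obtain ⟨x, hx⟩ := hM (r 0) (c 0)
  obtain ⟨y, hy⟩ := hM (r 0) (c 1)
  obtain ⟨z, hz⟩ := hM (r 1) (c 0)
  obtain ⟨w, hw⟩ := hM (r 1) (c 1)
  rw [eq_add_of_sub_eq hx, eq_add_of_sub_eq hy, eq_add_of_sub_eq hz, eq_add_of_sub_eq hw]
  exact ⟨x * (m * w + a (r 1) * b (c 1)) + a (r 0) * b (c 0) * w
    - y * (m * z + a (r 1) * b (c 0)) - a (r 0) * b (c 1) * z, by ring⟩

lemma minor_mem_detIdeal_two {n : ℕ} (M : Matrix (Fin n) (Fin n) ℤ) {i j k l : Fin n}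
    (hij : i ≠ j) (hkl : k ≠ l) : M i k * M j l - M i l * M j k ∈ detIdeal M 2 := by
  refine Ideal.subset_span ⟨![i, j], ![k, l], ?_, ?_, ?_⟩
  · intro x y; fin_cases x <;> fin_cases y <;> simp [hij, hij.symm]
  · intro x y; fin_cases x <;> fin_cases y <;> simp [hkl, hkl.symm]
  · rw [Matrix.det_fin_two]; simp

lemma starGraph_adj {n : ℕ} (u v : Fin n) :
    (starGraph n).Adj u v ↔ u ≠ v ∧ (u.val = 0 ∨ v.val = 0) := by
  simp [starGraph, SimpleGraph.fromRel_adj]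

lemma starGraph_dist {n : ℕ} (u v : Fin n) :
    (starGraph n).dist u v = if u = v then 0 else if u.val = 0 ∨ v.val = 0 then 1 else 2 := by
  split_ifs with h h'
  · simp [h]
  · exact SimpleGraph.dist_eq_one_iff_adj.2 ((starGraph_adj u v).2 ⟨h, h'⟩)
  · push Not at h'
    let c : Fin n := ⟨0, by omega⟩
    have huc : (starGraph n).Adj u c :=
      (starGraph_adj _ _).2 ⟨fun e => h'.1 (by simp [e, c]), Or.inr rfl⟩
    have hcv : (starGraph n).Adj c v :=
      (starGraph_adj _ _).2 ⟨fun e => h'.2 (by simp [← e, c]), Or.inl rfl⟩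
    have hle := SimpleGraph.dist_le (huc.toWalk.append hcv.toWalk)
    have h0 := (huc.reachable.trans hcv.reachable).pos_dist_of_ne h
    have h1 : (starGraph n).dist u v ≠ 1 := fun e =>
      h'.1 ((((starGraph_adj u v).1 (SimpleGraph.dist_eq_one_iff_adj.1 e)).2).resolve_right h'.2)
    simp at hle
    omega

lemma sum_starGraph_dist {n : ℕ} (u : Fin n) :
    ∑ w, ((starGraph n).dist u w : ℤ) = if u.val = 0 then (n : ℤ) - 1 else 2 * n - 3 := by
  obtain ⟨k, rfl⟩ : ∃ k, n = k + 1 := ⟨n - 1, by have := u.isLt; omega⟩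
  split_ifs with hu
  · have hu' : u = 0 := Fin.ext hu
    subst hu'
    rw [Fin.sum_univ_succ]
    simp [starGraph_dist, (Fin.succ_ne_zero _).symm]
  · have key : ∀ w : Fin (k + 1), ((starGraph (k + 1)).dist u w : ℤ) =
        2 - (if w = u then 2 else 0) - (if w = 0 then 1 else 0) := by
      intro w
      rw [starGraph_dist]
      have : w = 0 ↔ w.val = 0 := Fin.ext_iff
      by_cases h1 : u = w
      · subst h1; simp [this, hu]
      · by_cases h2 : w.val = 0 <;> simp [h1, Ne.symm h1, hu, h2, this]
    simp only [key, Finset.sum_sub_distrib, Finset.sum_ite_eq', Finset.mem_univ, if_true]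
    simp
    ring

lemma detIdeal_distLap_starGraph_le (n : ℕ) :
    detIdeal (distLap (starGraph n)) 2 ≤ Ideal.span {2 * (n : ℤ) - 1} := by
  refine detIdeal_two_le_span _ _ (fun u => if u.val = 0 then (n : ℤ) else 1)
    (fun u => -2 * if u.val = 0 then (n : ℤ) else 1) fun u v => ?_
  rw [distLap]
  by_cases huv : u = v
  · subst huv
    rw [if_pos rfl, sum_starGraph_dist]
    split_ifs
    · exact ⟨n + 1, by ring⟩
    · exact ⟨1, by ring⟩
  · rw [if_neg huv, starGraph_dist, if_neg huv]
    by_cases hu : u.val = 0 <;> by_cases hv : v.val = 0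
    · exact absurd (Fin.ext (hu.trans hv.symm)) huv
    · exact ⟨1, by simp [hu, hv]; ring⟩
    · exact ⟨1, by simp [hu, hv]; ring⟩
    · exact ⟨0, by simp [hu, hv]⟩

/-- A connected non-complete graph contains an induced path on three vertices. -/
lemma exists_induced_path_of_connected {V : Type*} {G : SimpleGraph V} (hG : G.Connected)
    (hne : G ≠ ⊤) : ∃ u v w, G.Adj u v ∧ G.Adj v w ∧ u ≠ w ∧ ¬ G.Adj u w := by
  by_contra! H
  refine hne (top_unique fun u w huw => ?_)
  obtain ⟨p⟩ := hG u w
  have key : ∀ {a b : V}, G.Walk a b → a = b ∨ G.Adj a b := by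
    intro a b p
    induction p with
    | nil => exact Or.inl rfl
    | @cons a c b hac q ih =>
      by_cases hab : a = b
      · exact Or.inl hab
      · rcases ih with rfl | hcb
        · exact Or.inr hac
        · exact Or.inr (H _ _ _ hac hcb hab)
  exact (key p).resolve_left huw

lemma nonempty_iso_starGraph {n : ℕ} (G : SimpleGraph (Fin n)) (v : Fin n)
    (hv : ∀ x y, G.Adj x y ↔ x ≠ y ∧ (x = v ∨ y = v)) : Nonempty (G ≃g starGraph n) := by
  let c : Fin n := ⟨0, v.pos⟩
  have hc : ∀ x, (Equiv.swap v c x).val = 0 ↔ x = v := by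
    intro x
    rw [← Equiv.apply_eq_iff_eq (Equiv.swap v c), Equiv.swap_apply_left, Fin.ext_iff]
  exact ⟨⟨Equiv.swap v c, by intro x y; simp [starGraph_adj, hv, hc]⟩⟩

lemma dist_lt_of_connected {n : ℕ} {G : SimpleGraph (Fin n)} (hG : G.Connected) (x y : Fin n) :
    G.dist x y < n := by
  obtain ⟨p, hp, hl⟩ := hG.exists_path_of_dist x y
  simpa [hl] using hp.length_lt

/-- Star graphs are determined by the Smith normal form of the distance Laplacian
matrix: if a connected graph `G` on `n ≥ 2` vertices has, for every `1 ≤ k ≤ n`, the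
same `k`-th determinantal ideal over `ℤ` of its distance Laplacian as the star
`K_{1,n−1}` (equivalently, the same SNF of the distance Laplacian), then
`G ≅ K_{1,n−1}`. -/
theorem starGraph_determined_by_SNF_distLap {n : ℕ} (hn : 2 ≤ n)
    (G : SimpleGraph (Fin n)) (hG : G.Connected)
    (h : ∀ k : ℕ, 1 ≤ k → k ≤ n →
      detIdeal (distLap G) k = detIdeal (distLap (starGraph n)) k) :
    Nonempty (G ≃g starGraph n) := by
  have hminor : ∀ i j k l : Fin n, i ≠ j → k ≠ l → 2 * (n : ℤ) - 1 ∣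
      distLap G i k * distLap G j l - distLap G i l * distLap G j k := fun i j k l hij hkl =>
    Ideal.mem_span_singleton.1 (detIdeal_distLap_starGraph_le n
      (h 2 (by norm_num) hn ▸ minor_mem_detIdeal_two (distLap G) hij hkl))
  have hoff : ∀ {x y : Fin n}, x ≠ y → distLap G x y = -(G.dist x y : ℤ) := fun hxy => if_neg hxy
  have hlt := dist_lt_of_connected hG
  by_cases htop : G = ⊤
  · rcases hn.eq_or_lt with rfl | hn3
    · refine nonempty_iso_starGraph G 0 fun x y => ?_
      subst htop
      fin_cases x <;> fin_cases y <;> simp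
    · exfalso
      let a : Fin n := ⟨0, by omega⟩
      let b : Fin n := ⟨1, by omega⟩
      let c : Fin n := ⟨2, by omega⟩
      have hab : a ≠ b := by simp [a, b]
      have hac : a ≠ c := by simp [a, c]
      have hbc : b ≠ c := by simp [b, c]
      have hd : ∀ {x y : Fin n}, x ≠ y → G.dist x y = 1 := fun hxy =>
        SimpleGraph.dist_eq_one_iff_adj.2 (by simpa [htop] using hxy)
      have hT : distLap G a a = (n : ℤ) - 1 := by
        have hs : ∀ w, (G.dist a w : ℤ) = 1 - if w = a then 1 else 0 := by
          intro w
          split_ifs with hw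
          · simp [hw]
          · simp [hd (Ne.symm hw)]
        simp [distLap, hs]
      have hm := hminor a b a c hab hac
      rw [hT, hoff hbc, hoff hac, hoff hab.symm, hd hbc, hd hac, hd hab.symm] at hm
      have := Int.le_of_dvd (by omega) (by simpa using (dvd_neg.2 hm) :
        2 * (n : ℤ) - 1 ∣ n)
      omega
  · obtain ⟨u, v, w, huv, hvw, huw, hnuw⟩ := exists_induced_path_of_connected hG htop
    have h4 : ∀ {a b c d : Fin n}, a ≠ b → c ≠ d → a ≠ c → a ≠ d → b ≠ c → b ≠ d →
        2 * (n : ℤ) - 1 ∣ (G.dist a c : ℤ) * G.dist b d - G.dist a d * G.dist b c := by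
      intro a b c d hab hcd hac had hbc hbd
      have := hminor a b c d hab hcd
      rwa [hoff hac, hoff hbd, hoff had, hoff hbc, neg_mul_neg, neg_mul_neg] at this
    have hduv : G.dist u v = 1 := SimpleGraph.dist_eq_one_iff_adj.2 huv
    have hdvw : G.dist v w = 1 := SimpleGraph.dist_eq_one_iff_adj.2 hvw
    have hduw : G.dist u w = 2 := by
      have h1 := hG.dist_triangle (u := u) (v := v) (w := w)
      have h2 := hG.pos_dist_of_ne huw
      have h3 : G.dist u w ≠ 1 := fun e => hnuw (SimpleGraph.dist_eq_one_iff_adj.1 e)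
      omega
    have hx : ∀ x, x ≠ u → x ≠ v → x ≠ w → G.dist v x = 1 ∧ G.dist u x = 2 := by
      intro x hxu hxv hxw
      have hm := h4 (a := u) (b := v) (c := w) (d := x) huv.ne hxw.symm huw hxu.symm hvw.ne hxv.symm
      rw [hduw, hdvw] at hm
      have h1 := hG.dist_triangle (u := u) (v := v) (w := x)
      have h2 := hG.pos_dist_of_ne hxv.symm
      have h3 := hlt v x
      have h4 := hlt u x
      have h5 := Int.eq_zero_of_abs_lt_dvd hm (abs_lt.2 ⟨by push_cast; omega, by push_cast; omega⟩)
      push_cast at h5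
      omega
    have hx' : ∀ x, x ≠ u → x ≠ v → G.dist v x = 1 ∧ G.dist u x = 2 := by
      intro x hxu hxv
      by_cases hxw : x = w
      · subst hxw; exact ⟨hdvw, hduw⟩
      · exact hx x hxu hxv hxw
    refine nonempty_iso_starGraph G v fun x y => ⟨fun hxy => ⟨hxy.ne, ?_⟩, ?_⟩
    · by_contra! hne
      obtain ⟨hxv, hyv⟩ := hne
      have hdxy := SimpleGraph.dist_eq_one_iff_adj.2 hxy
      by_cases hxu : x = u
      · subst hxu
        have := (hx' y hxy.ne' hyv).2
        omega
      by_cases hyu : y = u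
      · subst hyu
        have := (hx' x hxy.ne hxv).2
        rw [SimpleGraph.dist_comm] at this
        omega
      have hm := h4 (a := u) (b := x) (c := v) (d := y) (Ne.symm hxu) (Ne.symm hyv) huv.ne
        (Ne.symm hyu) hxv hxy.ne
      rw [hduv, hdxy, (hx' y hyu hyv).2, G.dist_comm (u := x), (hx' x hxu hxv).1] at hm
      have := Int.le_of_dvd (by norm_num) (by simpa using hm : 2 * (n : ℤ) - 1 ∣ 1)
      omega
    · have hadj : ∀ z, z ≠ v → G.Adj v z := by
        intro z hz
        by_cases hzu : z = u
        · exact hzu ▸ huv.symm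
        · exact SimpleGraph.dist_eq_one_iff_adj.1 (hx' z hzu hz).1
      rintro ⟨hne, rfl | rfl⟩
      · exact hadj y hne.symm
      · exact (hadj x hne).symm
end
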